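/- Let θ₁, θ₂, θ₀ be extended configurations such that θ₁, θ₂ →merge θ₀. If θ'₁ ⪯ θ₁ and θ'₂ ⪯ θ₂, then there exist extended configurations θ̂'₁ ∼ θ'₁, θ̂'₂ ∼ θ'₂ and θ'₀ such that θ'₀ ⪯ θ₀ and {θ̂'₁, θ̂'₂} ⟹ⁿ θ'₀ for some n bounded by a computable function of θ'₁ and θ'₂. -/

import Mathlib

namespace ECBUDA

/-- Evaluation of a nonempty word under the semigroup homomorphism determined
by the letter map `h` (and `none` on the empty word). -/
def hword {A B S : Type} [Mul S] (h : A × B → S) : List (A × B) → Option S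
  | [] => none
  | c :: w => some (w.foldl (fun s x => s * h x) (h c))

/-- (NF1): the homomorphism takes distinct values on words of length one:
`h(w) = h(c)` iff `w = c`. -/
def NF1 {A B S : Type} [Mul S] (h : A × B → S) : Prop :=
  ∀ (w : List (A × B)) (c : A × B), hword h w = some (h c) ↔ w = [c]

/-- Basic tests allowed in normal form (NF2): state tests, `⟨μ⟩^=`, `⟨μ⟩^≠`
and `root`. -/
inductive NTest (Q S : Type) : Type where
  | state : Q → NTest Q S
  | deq : S → NTest Q S
  | dneq : S → NTest Q S
  | root : NTest Q S

/-- Basic actions. -/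
inductive NAct (Q : Type) : Type where
  | accept : NAct Q
  | keep : Q → NAct Q
  | store : Q → NAct Q
  | guess : Q → NAct Q
  | univ : Q → NAct Q

/-- The set `TA`: possibly negated basic tests (the Boolean flag `true` marks
negation), basic actions, and the three symbols `⊤`, `⊤g`, `⊥`. -/
inductive TA (Q S : Type) : Type where
  | test : Bool → NTest Q S → TA Q S
  | act : NAct Q → TA Q S
  | top : TA Q S
  | topg : TA Q S
  | bot : TA Q S

/-- A transition of the automaton in normal form: a conjunction of possibly
negated basic tests with a conjunction of basic actions. -/
abbrev NTrans (Q S : Type) : Type := List (Bool × NTest Q S) × List (NAct Q)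

/-- An extended configuration `(Δ, Γ, r, m)`: `Δ` a finite set of threads,
`Γ` a finite set of pairs (semigroup element, data value) containing exactly
one pair whose first component is the image under `h` of a letter (this letter
is the label of the configuration and the associated data value its data
value), and Booleans `r` (root) and `m` (merge). -/
structure EConf (A B Q S : Type) (D : Type) (h : A × B → S) : Type where
  Δ : Set (Q × TA Q S × D)
  Γ : Set (S × D)
  r : Bool
  m : Bool
  finΔ : Δ.Finite
  finΓ : Γ.Finite
  uniq : ∃! x : S × D, x ∈ Γ ∧ ∃ c : A × B, x.1 = h c

variable {A B Q S D : Type} {h : A × B → S}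

/-- `Δ(d)`: the threads carrying the data value `d`. -/
def EConf.dfun (θ : EConf A B Q S D h) (d : D) : Set (Q × TA Q S) :=
  {qa | (qa.1, qa.2, d) ∈ θ.Δ}

/-- `Γ(d)`: the semigroup elements of downward paths leading to `d`. -/
def EConf.gfun (θ : EConf A B Q S D h) (d : D) : Set S :=
  {μ | (μ, d) ∈ θ.Γ}

/-- The data values occurring in the extended configuration. -/
def EConf.dataset (θ : EConf A B Q S D h) : Set D :=
  {d | (∃ qa : Q × TA Q S, (qa.1, qa.2, d) ∈ θ.Δ) ∨ ∃ μ : S, (μ, d) ∈ θ.Γ}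

/-- The unique pair of `Γ` recording the label and the data value of the root. -/
def EConf.rootInfo (θ : EConf A B Q S D h) : Set (S × D) :=
  {x ∈ θ.Γ | ∃ c : A × B, x.1 = h c}

/-- The set of data values of the root pair (a singleton). -/
def EConf.rootData (θ : EConf A B Q S D h) : Set D :=
  {d | ∃ μ : S, (μ, d) ∈ θ.Γ ∧ ∃ c : A × B, μ = h c}

/-- The profile `(A₀, A₁, r, m)` of an extended configuration: `Aᵢ` is the set
of those `χ ⊆ S` such that exactly `i` data values `d` satisfy `Γ(d) = χ`. -/
def EConf.profile (θ : EConf A B Q S D h) :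
    Set (Set S) × Set (Set S) × Bool × Bool :=
  ({χ | {d | θ.gfun d = χ}.encard = 0},
   {χ | {d | θ.gfun d = χ}.encard = 1}, θ.r, θ.m)

/-- `θ₁ ⪯_f θ₂`. -/
def pleF (f : D → D) (θ₁ θ₂ : EConf A B Q S D h) : Prop :=
  θ₁.profile = θ₂.profile ∧ θ₁.dataset ⊆ Set.range f ∧
  ∀ d : D, θ₁.dfun (f d) ⊆ θ₂.dfun d ∧ θ₁.gfun (f d) = θ₂.gfun d

/-- The well-quasi-order `⪯` on extended configurations. -/
def ple (θ₁ θ₂ : EConf A B Q S D h) : Prop :=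
  ∃ f : D → D, pleF f θ₁ θ₂

/-- `θ₁ ∼ θ₂`: equal up to a bijection of the data values. -/
def simEquiv (θ₁ θ₂ : EConf A B Q S D h) : Prop :=
  ∃ g : D ≃ D,
    θ₂.Δ = {x | (x.1, x.2.1, g.symm x.2.2) ∈ θ₁.Δ} ∧
    θ₂.Γ = {x | (x.1, g.symm x.2) ∈ θ₁.Γ} ∧
    θ₂.r = θ₁.r ∧ θ₂.m = θ₁.m

/-- The closure of a set of extended configurations under `∼`. -/
def simClose (Θ : Set (EConf A B Q S D h)) : Set (EConf A B Q S D h) :=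
  {θ | ∃ θ' ∈ Θ, simEquiv θ θ'}

/-- `Θ ≤min Θ'`: every member of `Θ'` is minorized by a member of `Θ`. -/
def leMin (Θ Θ' : Set (EConf A B Q S D h)) : Prop :=
  ∀ θ' ∈ Θ', ∃ θ ∈ Θ, ple θ θ'

/-- Satisfaction of a basic test by the thread `(q, d)` in an extended
configuration. -/
def ntestHolds (θ : EConf A B Q S D h) (q : Q) (d : D) : NTest Q S → Prop
  | .state p => q = p
  | .deq μ => (μ, d) ∈ θ.Γ
  | .dneq μ => ∃ e : D, e ≠ d ∧ (μ, e) ∈ θ.Γ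
  | .root => θ.r = true

def taTestHolds (θ : EConf A B Q S D h) (q : Q) (d : D) (neg : Bool)
    (t : NTest Q S) : Prop :=
  if neg then ¬ ntestHolds θ q d t else ntestHolds θ q d t

/-- The tests and actions occurring in a transition, as elements of `TA`. -/
def taSet (tr : NTrans Q S) : Set (TA Q S) :=
  {x | (∃ nt ∈ tr.1, x = TA.test nt.1 nt.2) ∨ ∃ a ∈ tr.2, x = TA.act a}

/-- The ε-transitions of the transition system: they keep `Γ`, `r` (hence the
label and data value), require the merge flag to be false, and rewrite one
thread of `Δ`. -/
def epsStep (δ : List (NTrans Q S)) (θ₁ θ₂ : EConf A B Q S D h) : Prop :=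
  θ₁.m = false ∧ θ₂.m = false ∧ θ₂.r = θ₁.r ∧ θ₂.Γ = θ₁.Γ ∧
  ∃ (q : Q) (d : D),
    -- applying a transition of δ to a ⊥-thread
    ((∃ tr ∈ δ, (q, TA.bot, d) ∈ θ₁.Δ ∧
        θ₂.Δ = (θ₁.Δ \ {(q, TA.bot, d)}) ∪
          {x | x.1 = q ∧ x.2.2 = d ∧ x.2.1 ∈ taSet tr}) ∨
    -- univ
    (∃ p : Q, (q, TA.act (NAct.univ p), d) ∈ θ₁.Δ ∧
        θ₂.Δ = (θ₁.Δ \ {(q, TA.act (NAct.univ p), d)}) ∪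
          {x | x.1 = p ∧ x.2.1 = TA.top ∧ ∃ μ : S, (μ, x.2.2) ∈ θ₁.Γ}) ∨
    -- guess
    (∃ (p : Q) (d' : D), (q, TA.act (NAct.guess p), d) ∈ θ₁.Δ ∧
        θ₂.Δ = (θ₁.Δ \ {(q, TA.act (NAct.guess p), d)}) ∪ {(p, TA.topg, d')}) ∨
    -- store
    (∃ (p : Q) (d' : D), (q, TA.act (NAct.store p), d) ∈ θ₁.Δ ∧
        d' ∈ θ₁.rootData ∧
        θ₂.Δ = (θ₁.Δ \ {(q, TA.act (NAct.store p), d)}) ∪ {(p, TA.top, d')}) ∨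
    -- keep
    (∃ p : Q, (q, TA.act (NAct.keep p), d) ∈ θ₁.Δ ∧
        θ₂.Δ = (θ₁.Δ \ {(q, TA.act (NAct.keep p), d)}) ∪ {(p, TA.top, d)}) ∨
    -- accept
    ((q, TA.act NAct.accept, d) ∈ θ₁.Δ ∧
        θ₂.Δ = θ₁.Δ \ {(q, TA.act NAct.accept, d)}) ∨
    -- a (possibly negated) basic test, deleted if it holds
    (∃ (neg : Bool) (t : NTest Q S), (q, TA.test neg t, d) ∈ θ₁.Δ ∧
        taTestHolds θ₁ q d neg t ∧
        θ₂.Δ = θ₁.Δ \ {(q, TA.test neg t, d)}))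

/-- The transition `→inc(S, χ)`. -/
def incStep (Sq : Set (Q × TA Q S)) (χ : Set S) (θ₁ θ₂ : EConf A B Q S D h) :
    Prop :=
  (∃ d : D, θ₁.dfun d = Sq ∧ θ₁.gfun d = χ) ∧
  (∃ e₁ e₂ : D, e₁ ≠ e₂ ∧ θ₁.gfun e₁ = χ ∧ θ₁.gfun e₂ = χ) ∧
  ∃ e : D, e ∉ θ₁.dataset ∧ θ₂.r = θ₁.r ∧ θ₂.m = θ₁.m ∧
    (∀ d : D, d ≠ e → θ₂.dfun d = θ₁.dfun d ∧ θ₂.gfun d = θ₁.gfun d) ∧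
    θ₂.dfun e = {qa ∈ Sq | qa.2 ≠ TA.topg} ∧ θ₂.gfun e = χ

/-- The transition `→inc`. -/
def inc (θ₁ θ₂ : EConf A B Q S D h) : Prop :=
  ∃ (Sq : Set (Q × TA Q S)) (χ : Set S), incStep Sq χ θ₁ θ₂

/-- The transition `→grow`, adding a new root on top. -/
def growStep [Semigroup S] (θ₁ θ₂ : EConf A B Q S D h) : Prop :=
  θ₁.r = false ∧ θ₁.m = false ∧
  (∀ x ∈ θ₁.Δ, x.2.1 = TA.top ∨ x.2.1 = TA.topg) ∧
  θ₂.Δ = {x | x.2.1 = TA.bot ∧ ∃ α : TA Q S, (x.1, α, x.2.2) ∈ θ₁.Δ} ∧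
  ∃ (c : A × B) (d' : D),
    θ₂.Γ = {y | ∃ μ : S, ∃ e : D, (μ, e) ∈ θ₁.Γ ∧ y = (h c * μ, e)} ∪ {(h c, d')}

/-- The transition `→merge`, merging two extended configurations with the same
label and data value. -/
def mergeStep (θ₁ θ₂ θ₀ : EConf A B Q S D h) : Prop :=
  θ₁.rootInfo = θ₂.rootInfo ∧ θ₀.rootInfo = θ₁.rootInfo ∧
  θ₁.m = true ∧ θ₂.m = true ∧ θ₀.r = θ₁.r ∧ θ₁.r = θ₂.r ∧
  θ₀.Δ = θ₁.Δ ∪ θ₂.Δ ∧ θ₀.Γ = θ₁.Γ ∪ θ₂.Γ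

/-- Any single (ε-, inc- or grow-) transition step of the transition system. -/
def anyStep [Semigroup S] (δ : List (NTrans Q S)) (θ₁ θ₂ : EConf A B Q S D h) :
    Prop :=
  epsStep δ θ₁ θ₂ ∨ inc θ₁ θ₂ ∨ growStep θ₁ θ₂

/-- `Θ ⟹ θ`: one derivation step from a set of extended configurations. -/
def stepFrom [Semigroup S] (δ : List (NTrans Q S))
    (Θ : Set (EConf A B Q S D h)) (θ : EConf A B Q S D h) : Prop :=
  (∃ θ₁ ∈ Θ, anyStep δ θ₁ θ) ∨ ∃ θ₁ ∈ Θ, ∃ θ₂ ∈ Θ, mergeStep θ₁ θ₂ θ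

/-- `Θ ⟹⁺ θ`. -/
inductive Derives [Semigroup S] (δ : List (NTrans Q S)) :
    Set (EConf A B Q S D h) → EConf A B Q S D h → Prop where
  | base {Θ : Set (EConf A B Q S D h)} {θ : EConf A B Q S D h} :
      stepFrom δ Θ θ → Derives δ Θ θ
  | step {Θ : Set (EConf A B Q S D h)} {θ' θ : EConf A B Q S D h} :
      stepFrom δ Θ θ' → Derives δ (Θ ∪ {θ'}) θ → Derives δ Θ θ

/-- `Θ ⟹ⁿ θ`: derivation in at most `n` steps. -/
inductive DerivesN [Semigroup S] (δ : List (NTrans Q S)) :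
    ℕ → Set (EConf A B Q S D h) → EConf A B Q S D h → Prop where
  | base {n : ℕ} {Θ : Set (EConf A B Q S D h)} {θ : EConf A B Q S D h} :
      stepFrom δ Θ θ → DerivesN δ (n + 1) Θ θ
  | step {n : ℕ} {Θ : Set (EConf A B Q S D h)} {θ' θ : EConf A B Q S D h} :
      stepFrom δ Θ θ' → DerivesN δ n (Θ ∪ {θ'}) θ → DerivesN δ (n + 1) Θ θ

/-- `n`-fold composition of a binary relation. -/
def relPow {α : Type} (R : α → α → Prop) : ℕ → α → α → Prop
  | 0 => Eq
  | n + 1 => fun a c => ∃ b, R a b ∧ relPow R n b c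

/-- An initial extended configuration (abstracting a leaf). -/
def Initial (q0 : Q) (θ : EConf A B Q S D h) : Prop :=
  (∃ d : D, θ.Δ = {(q0, TA.bot, d)}) ∧
  ∃ (c : A × B) (d' : D), θ.Γ = {(h c, d')}

/-- An accepting extended configuration: no remaining threads. -/
def Accepting (θ : EConf A B Q S D h) : Prop := θ.Δ = ∅

/-- The restriction to the data values in `P` of the pullback of `θ'` along `f`,
where `⊤g`-threads are kept only on the data values in `O`. -/
def pconf (θ θ' : EConf A B Q S D h) (f : D → D)
    (hf : ∀ d : D, θ'.dfun (f d) ⊆ θ.dfun d ∧ θ'.gfun (f d) = θ.gfun d)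
    (O P : Set D) (hP : θ.rootData ⊆ P) : EConf A B Q S D h where
  Δ := {x | x.2.2 ∈ P ∧ (x.1, x.2.1, f x.2.2) ∈ θ'.Δ ∧ (x.2.1 ≠ TA.topg ∨ x.2.2 ∈ O)}
  Γ := {x | x.2 ∈ P ∧ x ∈ θ.Γ}
  r := θ.r
  m := θ.m
  finΔ := by
    refine θ.finΔ.subset ?_
    rintro ⟨q, α, d⟩ ⟨-, h2, -⟩
    have h3 : (q, α) ∈ θ'.dfun (f d) := h2
    exact (hf d).1 h3
  finΓ := θ.finΓ.subset (fun x hx => hx.2)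
  uniq := by
    obtain ⟨⟨μ, d⟩, ⟨h1, h2⟩, h3⟩ := θ.uniq
    refine ⟨(μ, d), ⟨⟨hP ⟨μ, h1, h2⟩, h1⟩, h2⟩, ?_⟩
    rintro y ⟨⟨-, hy⟩, hc⟩
    exact h3 y ⟨hy, hc⟩

theorem EConf.finite_dataset (θ : EConf A B Q S D h) : θ.dataset.Finite := by
  refine ((θ.finΔ.image (fun x => x.2.2)).union (θ.finΓ.image (fun x => x.2))).subset ?_
  rintro d (⟨qa, hq⟩ | ⟨μ, hμ⟩)
  · exact Or.inl ⟨_, hq, rfl⟩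
  · exact Or.inr ⟨_, hμ, rfl⟩

theorem EConf.mem_dataset_of_gfun {θ : EConf A B Q S D h} {d : D}
    (hd : θ.gfun d ≠ ∅) : d ∈ θ.dataset := by
  obtain ⟨μ, hμ⟩ := Set.nonempty_iff_ne_empty.2 hd
  exact Or.inr ⟨μ, hμ⟩

theorem EConf.gfun_eq_empty {θ : EConf A B Q S D h} {d : D}
    (hd : d ∉ θ.dataset) : θ.gfun d = ∅ := by
  by_contra h0
  exact hd (EConf.mem_dataset_of_gfun h0)

theorem EConf.dfun_eq_empty {θ : EConf A B Q S D h} {d : D}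
    (hd : d ∉ θ.dataset) : θ.dfun d = ∅ := by
  by_contra h0
  obtain ⟨μ, hμ⟩ := Set.nonempty_iff_ne_empty.2 h0
  exact hd (Or.inl ⟨μ, hμ⟩)

/-- Infinitely many data values are absent from a configuration. -/
theorem EConf.infinite_blank [Infinite D] (θ : EConf A B Q S D h) :
    {d | θ.gfun d = ∅}.Infinite := by
  refine Set.Infinite.mono ?_ θ.finite_dataset.infinite_compl
  intro d hd
  exact EConf.gfun_eq_empty hd

theorem pconf_dfun (θ θ' : EConf A B Q S D h) (f : D → D)
    (hf : ∀ d : D, θ'.dfun (f d) ⊆ θ.dfun d ∧ θ'.gfun (f d) = θ.gfun d)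
    (O P : Set D) (hP : θ.rootData ⊆ P) (d : D) :
    (pconf θ θ' f hf O P hP).dfun d =
      {qa | d ∈ P ∧ qa ∈ θ'.dfun (f d) ∧ (qa.2 ≠ TA.topg ∨ d ∈ O)} := rfl

theorem pconf_gfun (θ θ' : EConf A B Q S D h) (f : D → D)
    (hf : ∀ d : D, θ'.dfun (f d) ⊆ θ.dfun d ∧ θ'.gfun (f d) = θ.gfun d)
    (O P : Set D) (hP : θ.rootData ⊆ P) (d : D) :
    (pconf θ θ' f hf O P hP).gfun d = {μ | d ∈ P ∧ μ ∈ θ.gfun d} := rfl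

theorem pconf_inc [Infinite D] (θ θ' : EConf A B Q S D h) (f : D → D)
    (hpf : pleF f θ' θ)
    (hf : ∀ d : D, θ'.dfun (f d) ⊆ θ.dfun d ∧ θ'.gfun (f d) = θ.gfun d)
    (O P : Set D) (hP : θ.rootData ⊆ P) (hOP : O ⊆ P)
    (hO : ∀ x ∈ θ'.dataset, ∃ d ∈ O, f d = x) (e : D) (he : e ∉ P)
    (hP' : θ.rootData ⊆ insert e P) :
    inc (pconf θ θ' f hf O P hP) (pconf θ θ' f hf O (insert e P) hP') := by
  have hblank : ∀ d, d ∉ P → (pconf θ θ' f hf O P hP).dfun d = ∅ ∧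
      (pconf θ θ' f hf O P hP).gfun d = ∅ := by
    intro d hd
    rw [pconf_dfun, pconf_gfun]
    constructor <;> ext <;> simp [hd]
  have hin : ∀ d, d ∈ P → (pconf θ θ' f hf O P hP).gfun d = θ'.gfun (f d) := by
    intro d hd
    rw [pconf_gfun, (hf d).2]
    ext; simp [hd]
  refine ⟨θ'.dfun (f e), θ'.gfun (f e), ?_, ?_, e, ?_, rfl, rfl, ?_, ?_, ?_⟩
  · by_cases hx : f e ∈ θ'.dataset
    · obtain ⟨d, hd, hde⟩ := hO _ hx
      refine ⟨d, ?_, ?_⟩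
      · rw [pconf_dfun, hde]
        ext; simp [hd, hOP hd]
      · rw [hin d (hOP hd), hde]
    · refine ⟨e, ?_, ?_⟩
      · rw [(hblank e he).1, EConf.dfun_eq_empty hx]
      · rw [(hblank e he).2, EConf.gfun_eq_empty hx]
  · by_cases hχ : θ'.gfun (f e) = ∅
    · rw [hχ]
      obtain ⟨a, ha, b, hb, hab⟩ :=
        (EConf.infinite_blank (pconf θ θ' f hf O P hP)).nontrivial
      exact ⟨a, b, hab, ha, hb⟩
    · have hx := EConf.mem_dataset_of_gfun hχ
      obtain ⟨d, hd, hde⟩ := hO _ hx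
      have hne : d ≠ e := fun h => he (h ▸ hOP hd)
      have h1 : {a | θ'.gfun a = θ'.gfun (f e)}.encard ≠ 1 := by
        intro h1
        have hp := hpf.1
        have h2 : θ'.gfun (f e) ∈ θ.profile.2.1 := by
          rw [← hp]; exact h1
        obtain ⟨z, hz⟩ := Set.encard_eq_one.1 h2
        have hz1 : d ∈ ({z} : Set D) := by
          rw [← hz]; show θ.gfun d = _
          rw [← hde, (hf d).2]
        have hz2 : e ∈ ({z} : Set D) := by
          rw [← hz]; show θ.gfun e = _
          rw [(hf e).2]
        exact hne (hz1.trans hz2.symm)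
      have h3 : ∃ b, b ≠ f e ∧ θ'.gfun b = θ'.gfun (f e) := by
        by_contra hcon
        push Not at hcon
        apply h1
        rw [Set.encard_eq_one]
        refine ⟨f e, ?_⟩
        ext b
        constructor
        · intro hb
          by_contra hb'
          exact hcon b hb' hb
        · rintro rfl; rfl
      obtain ⟨b, hb, hbg⟩ := h3
      obtain ⟨d', hd', hde'⟩ := hO b (EConf.mem_dataset_of_gfun (by rw [hbg]; exact hχ))
      refine ⟨d, d', ?_, ?_, ?_⟩
      · rintro rfl
        exact hb (hde'.symm.trans hde)
      · rw [hin d (hOP hd), hde]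
      · rw [hin d' (hOP hd'), hde', hbg]
  · rintro (⟨qa, hq⟩ | ⟨μ, hμ⟩)
    · exact he hq.1
    · exact he hμ.1
  · intro d hd
    rw [pconf_dfun, pconf_gfun, pconf_dfun, pconf_gfun]
    simp [hd]
  · have heO : e ∉ O := fun h => he (hOP h)
    rw [pconf_dfun]
    ext; simp [heO]
  · rw [pconf_gfun, (hf e).2]
    ext; simp

theorem pconf_chain [Infinite D] (θ θ' : EConf A B Q S D h) (f : D → D)
    (hpf : pleF f θ' θ)
    (hf : ∀ d : D, θ'.dfun (f d) ⊆ θ.dfun d ∧ θ'.gfun (f d) = θ.gfun d)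
    (O R : Set D) (hR : R.Finite) (hO : ∀ x ∈ θ'.dataset, ∃ d ∈ O, f d = x)
    (hRr : θ.rootData ⊆ R) :
    ∀ (n : ℕ) (P : Set D) (hP : θ.rootData ⊆ P), O ⊆ P → P ⊆ R → (R \ P).ncard = n →
      relPow inc n (pconf θ θ' f hf O P hP) (pconf θ θ' f hf O R hRr) := by
  intro n
  induction n with
  | zero =>
    intro P hP hOP hPR hn
    rw [Set.ncard_eq_zero hR.diff] at hn
    have : P = R := hPR.antisymm (Set.diff_eq_empty.1 hn)
    subst this
    rfl
  | succ n ih =>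
    intro P hP hOP hPR hn
    have hne : (R \ P).Nonempty := by
      apply Set.nonempty_of_ncard_ne_zero; omega
    obtain ⟨e, heR, heP⟩ := hne
    have hP' : θ.rootData ⊆ insert e P := hP.trans (Set.subset_insert _ _)
    refine ⟨_, pconf_inc θ θ' f hpf hf O P hP hOP hO e heP hP', ?_⟩
    refine ih _ hP' (hOP.trans (Set.subset_insert _ _)) (Set.insert_subset heR hPR) ?_
    have : R \ insert e P = (R \ P) \ {e} := by
      ext; simp; tauto
    have hmem : e ∈ R \ P := ⟨heR, heP⟩
    rw [this, Set.ncard_sdiff_singleton_of_mem hmem, hn]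
    rfl

/-- From a representative of `θ'` one derives, by `inc` steps, a configuration
living on `R` whose `Γ` is the restriction of that of `θ`. -/
theorem exists_chain [Infinite D] (θ θ' : EConf A B Q S D h) (f : D → D)
    (hpf : pleF f θ' θ) (R : Set D) (hR : R.Finite)
    (hsec : ∀ x ∈ θ'.dataset, ∃ d ∈ R, f d = x) :
    ∃ (θh θ'' : EConf A B Q S D h) (n : ℕ), simEquiv θh θ' ∧ n ≤ R.ncard ∧
      relPow inc n θh θ'' ∧ θ''.r = θ.r ∧ θ''.m = θ.m ∧
      θ''.Γ = {x | x.2 ∈ R ∧ x ∈ θ.Γ} ∧ θ''.rootInfo = θ.rootInfo ∧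
      θ.rootData ⊆ R ∧
      ∀ x ∈ θ''.Δ, x.2.2 ∈ R ∧ (x.1, x.2.1, f x.2.2) ∈ θ'.Δ := by
  classical
  have hf := hpf.2.2
  choose! o hoR hof using hsec
  have hinj : Set.InjOn o θ'.dataset := by
    intro a ha b hb hab
    rw [← hof a ha, ← hof b hb, hab]
  set O : Set D := o '' θ'.dataset with hOdef
  have hO : ∀ x ∈ θ'.dataset, ∃ d ∈ O, f d = x := fun x hx => ⟨o x, ⟨x, hx, rfl⟩, hof x hx⟩
  have hOR : O ⊆ R := by
    rintro _ ⟨x, hx, rfl⟩; exact hoR x hx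
  have hrO : θ.rootData ⊆ O := by
    rintro d ⟨μ, hμ, hc⟩
    have h1 : μ ∈ θ'.gfun (f d) := by rw [(hf d).2]; exact hμ
    obtain ⟨d', hd', hfd⟩ := hO (f d) (Or.inr ⟨μ, h1⟩)
    have h2 : (μ, d') ∈ θ.Γ := by
      have : μ ∈ θ.gfun d' := by rw [← (hf d').2, hfd]; exact h1
      exact this
    have h3 := θ.uniq.unique ⟨h2, hc⟩ ⟨hμ, hc⟩
    have h4 : d' = d := congrArg Prod.snd h3
    rwa [← h4]
  have hrR := hrO.trans hOR
  obtain ⟨g, hg⟩ : ∃ g : D ≃ D, ∀ x : θ'.dataset, g x = o x := by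
    have hlt : Cardinal.mk θ'.dataset < Cardinal.mk D :=
      (Cardinal.lt_aleph0_iff_set_finite.2 θ'.finite_dataset).trans_le (Cardinal.aleph0_le_mk D)
    exact Cardinal.extend_function_of_lt
      ⟨fun x : θ'.dataset => o x, fun a b hab => Subtype.ext (hinj a.2 b.2 hab)⟩
      hlt ⟨Equiv.refl D⟩
  have hgO : ∀ a, g a ∈ O ↔ a ∈ θ'.dataset := by
    intro a
    constructor
    · rintro ⟨x, hx, hxa⟩
      rw [← hg ⟨x, hx⟩] at hxa
      have := g.injective hxa
      rwa [← this]
    · intro ha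
      rw [hg ⟨a, ha⟩]
      exact ⟨a, ha, rfl⟩
  have hgf : ∀ a, a ∈ θ'.dataset → f (g a) = a := by
    intro a ha
    rw [hg ⟨a, ha⟩]; exact hof a ha
  have hpr := hpf.1
  have hr : θ'.r = θ.r := congrArg (fun p => p.2.2.1) hpr
  have hm : θ'.m = θ.m := congrArg (fun p => p.2.2.2) hpr
  refine ⟨pconf θ θ' f hf O O hrO, pconf θ θ' f hf O R hrR, (R \ O).ncard, ?_,
    Set.ncard_le_ncard Set.diff_subset hR,
    pconf_chain θ θ' f hpf hf O R hR hO hrR _ O hrO subset_rfl hOR rfl, rfl, rfl, rfl, ?_,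
    hrR, ?_⟩
  · refine ⟨g.symm, ?_, ?_, hr, hm⟩
    · ext ⟨q, α, a⟩
      show _ ↔ (g a ∈ O ∧ (q, α, f (g a)) ∈ θ'.Δ ∧ (α ≠ TA.topg ∨ g a ∈ O))
      rw [hgO]
      constructor
      · intro hx
        have ha : a ∈ θ'.dataset := Or.inl ⟨(q, α), hx⟩
        rw [hgf a ha]
        exact ⟨ha, hx, Or.inr ha⟩
      · rintro ⟨ha, hx, -⟩
        rwa [hgf a ha] at hx
    · ext ⟨μ, a⟩
      show _ ↔ (g a ∈ O ∧ μ ∈ θ.gfun (g a))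
      rw [hgO, ← (hf (g a)).2]
      constructor
      · intro hx
        have ha : a ∈ θ'.dataset := Or.inr ⟨μ, hx⟩
        rw [hgf a ha]
        exact ⟨ha, hx⟩
      · rintro ⟨ha, hx⟩
        rwa [hgf a ha] at hx
  · ext ⟨μ, d⟩
    constructor
    · rintro ⟨⟨-, h1⟩, h2⟩
      exact ⟨h1, h2⟩
    · rintro ⟨h1, h2⟩
      exact ⟨⟨hrR ⟨μ, h1, h2⟩, h1⟩, h2⟩
  · rintro x ⟨h1, h2, -⟩
    exact ⟨h1, h2⟩

theorem derivesN_of_chain [Semigroup S] (δ : List (NTrans Q S)) (m : ℕ)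
    (θ'' ψ : EConf A B Q S D h) :
    ∀ (n : ℕ) (θ : EConf A B Q S D h) (Θ : Set (EConf A B Q S D h)),
      relPow inc n θ θ'' → θ ∈ Θ →
      (∀ Θ' : Set (EConf A B Q S D h), Θ ⊆ Θ' → θ'' ∈ Θ' → DerivesN δ m Θ' ψ) →
      DerivesN δ (m + n) Θ ψ := by
  intro n
  induction n with
  | zero =>
    intro θ Θ hc hθ hk
    have : θ = θ'' := hc
    subst this
    exact hk Θ subset_rfl hθ
  | succ n ih =>
    rintro θ Θ ⟨b, hb, hc⟩ hθ hk
    refine DerivesN.step (n := m + n) (θ' := b) (Or.inl ⟨θ, hθ, Or.inr (Or.inl hb)⟩) ?_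
    refine ih b _ hc (Or.inr rfl) ?_
    intro Θ' hs hm
    exact hk Θ' (Set.subset_union_left.trans hs) hm

open Classical in
/-- The key of a data value: its image if it occurs in `θ'`. -/
noncomputable def dkey (θ' : EConf A B Q S D h) (f : D → D) (d : D) : Option D :=
  if f d ∈ θ'.dataset then some (f d) else none

theorem dkey_eq {θ' : EConf A B Q S D h} {f : D → D} {d e : D}
    (hk : dkey θ' f d = dkey θ' f e) :
    θ'.dfun (f d) = θ'.dfun (f e) ∧ θ'.gfun (f d) = θ'.gfun (f e) := by
  unfold dkey at hk
  by_cases h1 : f d ∈ θ'.dataset <;> by_cases h2 : f e ∈ θ'.dataset <;> simp [h1, h2] at hk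
  · rw [hk]; simp
  · rw [EConf.dfun_eq_empty h1, EConf.dfun_eq_empty h2, EConf.gfun_eq_empty h1,
      EConf.gfun_eq_empty h2]; simp

theorem dkey_eq' {θ' : EConf A B Q S D h} {f : D → D} {d e : D}
    (hk : dkey θ' f d = dkey θ' f e) (he : f e ∈ θ'.dataset) : f d = f e := by
  unfold dkey at hk
  by_cases h1 : f d ∈ θ'.dataset <;> simp [h1, he] at hk
  exact hk

theorem dkey_mem (θ' : EConf A B Q S D h) (f : D → D) (d : D) :
    dkey θ' f d ∈ insert none (some '' θ'.dataset) := by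
  unfold dkey
  by_cases h1 : f d ∈ θ'.dataset <;> simp [h1]

/-- At most two representatives for each value of `k`. -/
theorem exists_reps {T : Type} (k : D → T) (K : Set T) (hK : K.Finite) (hk : ∀ d, k d ∈ K) :
    ∃ R : Set D, R.Finite ∧ R.ncard ≤ 2 * K.ncard ∧ (∀ d, ∃ e ∈ R, k e = k d) ∧
      ∀ a b, a ≠ b → k a = k b → ∃ c ∈ R, c ≠ a ∧ k c = k a := by
  have hr : (Set.range k).Finite := hK.subset (by rintro _ ⟨d, rfl⟩; exact hk d)
  have hrn : (Set.range k).ncard ≤ K.ncard :=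
    Set.ncard_le_ncard (by rintro _ ⟨d, rfl⟩; exact hk d) hK
  have huv : ∀ t ∈ Set.range k, ∃ p : D × D, k p.1 = t ∧ k p.2 = t ∧
      ((∃ a b, a ≠ b ∧ k a = t ∧ k b = t) → p.1 ≠ p.2) := by
    rintro _ ⟨d, rfl⟩
    by_cases hn : ∃ a b, a ≠ b ∧ k a = k d ∧ k b = k d
    · obtain ⟨a, b, hab, ha, hb⟩ := hn
      exact ⟨(a, b), ha, hb, fun _ => hab⟩
    · exact ⟨(d, d), rfl, rfl, fun h => absurd h hn⟩
  rcases isEmpty_or_nonempty D with hD | hD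
  · exact ⟨∅, by simp, by simp, fun d => hD.elim d, fun a => hD.elim a⟩
  choose! p hp1 hp2 hp3 using huv
  refine ⟨(fun t => (p t).1) '' Set.range k ∪ (fun t => (p t).2) '' Set.range k,
    (hr.image _).union (hr.image _), ?_, ?_, ?_⟩
  · refine (Set.ncard_union_le _ _).trans ?_
    have h1 := Set.ncard_image_le (f := fun t => (p t).1) hr
    have h2 := Set.ncard_image_le (f := fun t => (p t).2) hr
    omega
  · intro d
    exact ⟨_, Or.inl ⟨k d, ⟨d, rfl⟩, rfl⟩, hp1 _ ⟨d, rfl⟩⟩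
  · intro a b hab hkab
    have hne := hp3 (k a) ⟨a, rfl⟩ ⟨a, b, hab, rfl, hkab.symm⟩
    by_cases h1 : (p (k a)).1 = a
    · refine ⟨(p (k a)).2, Or.inr ⟨k a, ⟨a, rfl⟩, rfl⟩, ?_, hp2 _ ⟨a, rfl⟩⟩
      intro h2
      exact hne (h1.trans h2.symm)
    · exact ⟨(p (k a)).1, Or.inl ⟨k a, ⟨a, rfl⟩, rfl⟩, h1, hp1 _ ⟨a, rfl⟩⟩

/-- **Monotonicity for merge (Lemma 3.11)**: if `θ₁, θ₂ →merge θ₀`,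
`θ'₁ ⪯ θ₁` and `θ'₂ ⪯ θ₂`, then there are `θ̂₁ ∼ θ'₁`, `θ̂₂ ∼ θ'₂` and
`θ'₀ ⪯ θ₀` with `{θ̂₁, θ̂₂} ⟹ⁿ θ'₀` for some `n` bounded by a (computable)
function of `θ'₁` and `θ'₂`. -/
theorem monotonicity_merge (A B Q S D : Type) [Fintype A] [Fintype B]
    [Fintype Q] [Fintype S] [Semigroup S] [Infinite D] (h : A × B → S)
    (hNF1 : NF1 h) (δ : List (NTrans Q S)) :
    ∃ F : EConf A B Q S D h → EConf A B Q S D h → ℕ,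
      ∀ θ₁ θ₂ θ₀ θ'₁ θ'₂ : EConf A B Q S D h,
        mergeStep θ₁ θ₂ θ₀ → ple θ'₁ θ₁ → ple θ'₂ θ₂ →
        ∃ (θh₁ θh₂ θ'₀ : EConf A B Q S D h) (n : ℕ),
          simEquiv θh₁ θ'₁ ∧ simEquiv θh₂ θ'₂ ∧ ple θ'₀ θ₀ ∧
          n ≤ F θ'₁ θ'₂ ∧ DerivesN δ n {θh₁, θh₂} θ'₀ := by
  classical
  refine ⟨fun θ'₁ θ'₂ => 4 * ((insert none (some '' θ'₁.dataset)) ×ˢ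
    (insert none (some '' θ'₂.dataset))).ncard + 1, ?_⟩
  rintro θ₁ θ₂ θ₀ θ'₁ θ'₂ ⟨hm1, hm2, hm3, hm4, hm5, hm6, hm7, hm8⟩ ⟨f₁, hpf₁⟩ ⟨f₂, hpf₂⟩
  have hf₁ := hpf₁.2.2
  have hf₂ := hpf₂.2.2
  have hg₀ : ∀ d, θ₀.gfun d = θ'₁.gfun (f₁ d) ∪ θ'₂.gfun (f₂ d) := by
    intro d
    rw [(hf₁ d).2, (hf₂ d).2]
    ext μ
    show (μ, d) ∈ θ₀.Γ ↔ _
    rw [hm8]; rfl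
  have hd₀ : ∀ d, θ'₁.dfun (f₁ d) ∪ θ'₂.dfun (f₂ d) ⊆ θ₀.dfun d := by
    intro d qa hqa
    show (qa.1, qa.2, d) ∈ θ₀.Δ
    rw [hm7]
    exact hqa.imp (fun x => (hf₁ d).1 x) (fun x => (hf₂ d).1 x)
  set K : Set (Option D × Option D) := (insert none (some '' θ'₁.dataset)) ×ˢ
    (insert none (some '' θ'₂.dataset)) with hKdef
  have hK : K.Finite := ((θ'₁.finite_dataset.image _).insert _).prod
    ((θ'₂.finite_dataset.image _).insert _)
  obtain ⟨R, hR, hRn, hRe, hR2⟩ := exists_reps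
    (fun d => (dkey θ'₁ f₁ d, dkey θ'₂ f₂ d)) K hK
    (fun d => ⟨dkey_mem _ _ _, dkey_mem _ _ _⟩)
  simp only [Prod.mk.injEq] at hRe hR2
  choose ρ hρR hρ₁ hρ₂ using hRe
  have hs₁ : ∀ x ∈ θ'₁.dataset, ∃ d ∈ R, f₁ d = x := by
    intro x hx
    obtain ⟨d, rfl⟩ := hpf₁.2.1 hx
    exact ⟨ρ d, hρR d, dkey_eq' (hρ₁ d) hx⟩
  have hs₂ : ∀ x ∈ θ'₂.dataset, ∃ d ∈ R, f₂ d = x := by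
    intro x hx
    obtain ⟨d, rfl⟩ := hpf₂.2.1 hx
    exact ⟨ρ d, hρR d, dkey_eq' (hρ₂ d) hx⟩
  obtain ⟨θh₁, ψ₁, n₁, he₁, hn₁, hc₁, hr₁, hmm₁, hΓ₁, hi₁, hrd₁, hΔ₁⟩ :=
    exists_chain θ₁ θ'₁ f₁ hpf₁ R hR hs₁
  obtain ⟨θh₂, ψ₂, n₂, he₂, hn₂, hc₂, hr₂, hmm₂, hΓ₂, hi₂, hrd₂, hΔ₂⟩ :=
    exists_chain θ₂ θ'₂ f₂ hpf₂ R hR hs₂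
  have hroot : ∀ x ∈ θ₀.Γ, (∃ c, x.1 = h c) → x.2 ∈ R := by
    rintro ⟨μ, d⟩ hx hc
    have h1 : (μ, d) ∈ θ₀.rootInfo := ⟨hx, hc⟩
    rw [hm2] at h1
    exact hrd₁ ⟨μ, h1.1, hc⟩
  let ψ : EConf A B Q S D h :=
    { Δ := ψ₁.Δ ∪ ψ₂.Δ
      Γ := {x | x.2 ∈ R ∧ x ∈ θ₀.Γ}
      r := θ₀.r
      m := θ₀.m
      finΔ := ψ₁.finΔ.union ψ₂.finΔ
      finΓ := θ₀.finΓ.subset (fun x hx => hx.2)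
      uniq := by
        obtain ⟨x, ⟨h1, h2⟩, h3⟩ := θ₀.uniq
        exact ⟨x, ⟨⟨hroot x h1 h2, h1⟩, h2⟩, fun y hy => h3 y ⟨hy.1.2, hy.2⟩⟩ }
  have hψi : ψ.rootInfo = θ₀.rootInfo := by
    ext x
    constructor
    · rintro ⟨⟨-, h1⟩, h2⟩
      exact ⟨h1, h2⟩
    · rintro ⟨h1, h2⟩
      exact ⟨⟨hroot x h1 h2, h1⟩, h2⟩
  have hmerge : mergeStep ψ₁ ψ₂ ψ := by
    refine ⟨by rw [hi₁, hi₂, hm1], by rw [hψi, hi₁, hm2], by rw [hmm₁, hm3],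
      by rw [hmm₂, hm4], by rw [hr₁, ← hm5], by rw [hr₁, hr₂, hm6], rfl, ?_⟩
    rw [hΓ₁, hΓ₂]
    ext x
    show (x.2 ∈ R ∧ x ∈ θ₀.Γ) ↔ _
    rw [hm8]
    simp only [Set.mem_union, Set.mem_setOf_eq]
    tauto
  have hψg : ∀ d ∈ R, ψ.gfun d = θ₀.gfun d := by
    intro d hd
    ext μ
    show (d ∈ R ∧ (μ, d) ∈ θ₀.Γ) ↔ (μ, d) ∈ θ₀.Γ
    simp [hd]
  have hψg' : ∀ d, d ∉ R → ψ.gfun d = ∅ := by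
    intro d hd
    ext μ
    show (d ∈ R ∧ (μ, d) ∈ θ₀.Γ) ↔ _
    simp [hd]
  have hψd : ∀ d, ψ.dfun d ⊆ θ'₁.dfun (f₁ d) ∪ θ'₂.dfun (f₂ d) := by
    rintro d ⟨q, α⟩ (hx | hx)
    · exact Or.inl (hΔ₁ _ hx).2
    · exact Or.inr (hΔ₂ _ hx).2
  have hsame : ∀ a b, dkey θ'₁ f₁ a = dkey θ'₁ f₁ b → dkey θ'₂ f₂ a = dkey θ'₂ f₂ b →
      θ₀.gfun a = θ₀.gfun b := by
    intro a b h1 h2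
    rw [hg₀, hg₀, (dkey_eq h1).2, (dkey_eq h2).2]
  let F : D → D := fun d => if d ∈ R then d else ρ d
  have hF : ∀ d, F d ∈ R ∧ dkey θ'₁ f₁ (F d) = dkey θ'₁ f₁ d ∧
      dkey θ'₂ f₂ (F d) = dkey θ'₂ f₂ d := by
    intro d
    by_cases hd : d ∈ R
    · simp [F, hd]
    · simp [F, hd, hρR, hρ₁, hρ₂]
  have hFg : ∀ d, ψ.gfun (F d) = θ₀.gfun d := by
    intro d
    rw [hψg _ (hF d).1, hsame _ _ (hF d).2.1 (hF d).2.2]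
  have hzero : ∀ χ, {d | ψ.gfun d = χ} = ∅ ↔ {d | θ₀.gfun d = χ} = ∅ := by
    intro χ
    by_cases hχ : χ = ∅
    · subst hχ
      have h1 := (EConf.infinite_blank ψ).nonempty.ne_empty
      have h2 := (EConf.infinite_blank θ₀).nonempty.ne_empty
      exact ⟨fun h => absurd h h1, fun h => absurd h h2⟩
    · simp only [Set.eq_empty_iff_forall_notMem, Set.mem_setOf_eq]
      constructor
      · intro h1 d hd
        exact h1 (F d) ((hFg d).trans hd)
      · intro h1 d hd
        by_cases hdR : d ∈ R
        · exact h1 d ((hψg d hdR).symm.trans hd)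
        · exact hχ (hd.symm.trans (hψg' d hdR))
  have hone : ∀ χ, {d | ψ.gfun d = χ}.encard = 1 ↔ {d | θ₀.gfun d = χ}.encard = 1 := by
    intro χ
    by_cases hχ : χ = ∅
    · subst hχ
      rw [(EConf.infinite_blank ψ).encard_eq, (EConf.infinite_blank θ₀).encard_eq]
    · have hsub : ∀ d, ψ.gfun d = χ → d ∈ R ∧ θ₀.gfun d = χ := by
        intro d hd
        by_cases hdR : d ∈ R
        · exact ⟨hdR, (hψg d hdR).symm.trans hd⟩
        · exact absurd (hd.symm.trans (hψg' d hdR)) hχ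
      simp only [Set.encard_eq_one]
      constructor
      · rintro ⟨a, ha⟩
        have ha' : ∀ d, ψ.gfun d = χ ↔ d = a := fun d => Set.ext_iff.1 ha d
        obtain ⟨haR, haχ⟩ := hsub a ((ha' a).2 rfl)
        refine ⟨a, ?_⟩
        ext b
        refine ⟨?_, fun hb => by rw [Set.mem_singleton_iff.1 hb]; exact haχ⟩
        intro hb
        have hFb : F b = a := (ha' _).1 ((hFg b).trans hb)
        by_contra hba
        have hba : b ≠ a := hba
        have hk := (hF b).2
        rw [hFb] at hk
        obtain ⟨c, hcR, hca, hck⟩ := hR2 a b hba.symm hk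
        exact hca ((ha' c).1 (by rw [hψg c hcR, hsame c a hck.1 hck.2, haχ]))
      · rintro ⟨a, ha⟩
        have ha' : ∀ d, θ₀.gfun d = χ ↔ d = a := fun d => Set.ext_iff.1 ha d
        have hsub' : ∀ d, ψ.gfun d = χ → d = a := fun d hd => (ha' d).1 (hsub d hd).2
        have h1 : ψ.gfun (F a) = χ := (hFg a).trans ((ha' a).2 rfl)
        have h2 := hsub' _ h1
        refine ⟨a, ?_⟩
        ext b
        refine ⟨fun hb => hsub' b hb, fun hb => ?_⟩
        rw [Set.mem_singleton_iff.1 hb]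
        rw [h2] at h1
        exact h1
  have hple : ple ψ θ₀ := by
    refine ⟨F, ?_, ?_, ?_⟩
    · unfold EConf.profile
      simp only [Set.encard_eq_zero]
      refine Prod.ext ?_ (Prod.ext ?_ rfl)
      · ext χ; exact hzero χ
      · ext χ; exact hone χ
    · have hsub : ψ.dataset ⊆ R := by
        rintro d (⟨qa, hx | hx⟩ | ⟨μ, hx⟩)
        · exact (hΔ₁ _ hx).1
        · exact (hΔ₂ _ hx).1
        · exact hx.1
      intro d hd
      exact ⟨d, by simp [F, hsub hd]⟩
    · intro d
      refine ⟨?_, hFg d⟩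
      refine (hψd _).trans ?_
      rw [(dkey_eq (hF d).2.1).1, (dkey_eq (hF d).2.2).1]
      exact hd₀ d
  refine ⟨θh₁, θh₂, ψ, 1 + n₂ + n₁, he₁, he₂, hple, ?_, ?_⟩
  · show 1 + n₂ + n₁ ≤ 4 * K.ncard + 1
    omega
  · refine derivesN_of_chain δ (1 + n₂) ψ₁ ψ n₁ θh₁ _ hc₁ (Or.inl rfl) ?_
    intro Θ' hs hψ₁
    refine derivesN_of_chain δ 1 ψ₂ ψ n₂ θh₂ _ hc₂ (hs (Or.inr rfl)) ?_
    intro Θ'' hs' hψ₂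
    exact DerivesN.base (n := 0) (Or.inr ⟨ψ₁, hs' hψ₁, ψ₂, hψ₂, hmerge⟩)

end ECBUDA
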